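/- If a shape S ⊆ ℤ² is odd-symmetric, then there exists an RTAM system 𝒯 = (T, σ, 1) at temperature 1 with |dom σ| = 1 such that S weakly self-assembles in 𝒯. -/

import Mathlib

/-! # Reflexive Tile Assembly Model (RTAM) -/

/-- A glue: `none` is the null glue; `some (l, s)` has label `l : ℤ` and strength `s : ℕ`.
The complement of the label `l` is `-l`. -/
abbrev Glue : Type := Option (ℤ × ℕ)

/-- Strength with which two abutting glues bind: `s` if the labels are complementary and
the strengths are both equal to `s`, and `0` otherwise. -/
def glueBind : Glue → Glue → ℕ
  | some (l₁, s₁), some (l₂, s₂) => if l₂ = -l₁ ∧ s₂ = s₁ then s₁ else 0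
  | _, _ => 0

/-- Two abutting glues match (for mismatch-freeness): both null, or complementary labels
with equal strengths. -/
def GlueMatch (g h : Glue) : Prop :=
  (g = none ∧ h = none) ∨ ∃ l s, g = some (l, s) ∧ h = some (-l, s)

/-- A tile type: glues on the north, east, south and west sides (in that order). -/
abbrev TileType : Type := Glue × Glue × Glue × Glue

def TileType.north (t : TileType) : Glue := t.1
def TileType.east (t : TileType) : Glue := t.2.1
def TileType.south (t : TileType) : Glue := t.2.2.1
def TileType.west (t : TileType) : Glue := t.2.2.2

/-- A reflection `(h, v)`: `h` indicates a flip across the vertical axis (swapping east and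
west and negating `x`), `v` a flip across the horizontal axis (swapping north and south and
negating `y`).  `D = (false, false)`, `H = (true, false)`, `V = (false, true)`,
`B = (true, true)`. -/
abbrev Reflection : Type := Bool × Bool

/-- Composition of reflections (the Klein four-group). -/
def Reflection.comp (r s : Reflection) : Reflection := (xor r.1 s.1, xor r.2 s.2)

/-- The action of a reflection on a point of `ℤ²`. -/
def Reflection.onPoint (r : Reflection) (p : ℤ × ℤ) : ℤ × ℤ :=
  (if r.1 then -p.1 else p.1, if r.2 then -p.2 else p.2)

/-- The tile type obtained by reflecting `t` according to `r` (glues are unchanged, sides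
are permuted). -/
def TileType.reflect (t : TileType) (r : Reflection) : TileType :=
  (if r.2 then TileType.south t else TileType.north t,
   if r.1 then TileType.west t else TileType.east t,
   if r.2 then TileType.north t else TileType.south t,
   if r.1 then TileType.east t else TileType.west t)

/-- A placed tile: a tile type together with its reflection. -/
abbrev Placement : Type := TileType × Reflection

/-- An assembly: a partial function from `ℤ²` to placed tiles. -/
abbrev Assembly : Type := ℤ × ℤ → Option Placement

/-- The domain of an assembly. -/
def adom (α : Assembly) : Set (ℤ × ℤ) := {p | α p ≠ none}

/-- The glue presented by the placed tile `pl` at position `p` on the side facing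
position `q` (the null glue if `q` is not adjacent to `p`). -/
def facingGlue (pl : Placement) (p q : ℤ × ℤ) : Glue :=
  if q = (p.1 + 1, p.2) then TileType.east (TileType.reflect pl.1 pl.2)
  else if q = (p.1 - 1, p.2) then TileType.west (TileType.reflect pl.1 pl.2)
  else if q = (p.1, p.2 + 1) then TileType.north (TileType.reflect pl.1 pl.2)
  else if q = (p.1, p.2 - 1) then TileType.south (TileType.reflect pl.1 pl.2)
  else none

/-- The strength of the bond between the tiles of `α` at positions `p` and `q`. -/
def bondStrength (α : Assembly) (p q : ℤ × ℤ) : ℕ :=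
  match α p, α q with
  | some a, some b => glueBind (facingGlue a p q) (facingGlue b q p)
  | _, _ => 0

/-- Adjacency in the binding graph of `α`. -/
def BondAdj (α : Assembly) (p q : ℤ × ℤ) : Prop := 0 < bondStrength α p q

/-- `α` is `τ`-stable: every cut of its binding graph has total strength at least `τ`
(i.e. some finite set of crossing edges already has total strength at least `τ`). -/
def Stable (α : Assembly) (τ : ℕ) : Prop :=
  ∀ A : Set (ℤ × ℤ), A ⊆ adom α → A.Nonempty → (adom α \ A).Nonempty →
    ∃ E : Finset ((ℤ × ℤ) × (ℤ × ℤ)),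
      (∀ e ∈ E, e.1 ∈ A ∧ e.2 ∈ adom α \ A) ∧
      τ ≤ ∑ e ∈ E, bondStrength α e.1 e.2

/-- An RTAM tile assembly system: a finite tile set, a finite stable seed assembly, and a
temperature. -/
structure RTAS where
  tiles : Finset TileType
  seed : Assembly
  temp : ℕ
  seed_nonempty : (adom seed).Nonempty
  seed_finite : (adom seed).Finite
  seed_tiles : ∀ p pl, seed p = some pl → pl.1 ∈ tiles
  seed_stable : Stable seed temp

/-- `β` is obtained from `α` by `τ`-stably attaching a single tile (in any reflection) at
an empty position. -/
def Attaches (S : RTAS) (α β : Assembly) : Prop :=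
  ∃ (p : ℤ × ℤ) (t : TileType) (r : Reflection),
    α p = none ∧ t ∈ S.tiles ∧ β = Function.update α p (some (t, r)) ∧ Stable β S.temp

/-- Producible assemblies: those reachable from the seed in finitely many attachment steps
or in the limit. -/
def Producible (S : RTAS) (α : Assembly) : Prop :=
  ∃ f : ℕ → Assembly, f 0 = S.seed ∧
    (∀ n, f (n + 1) = f n ∨ Attaches S (f n) (f (n + 1))) ∧
    (∀ p pl, α p = some pl ↔ ∃ n, f n p = some pl)

/-- Terminal assemblies: producible assemblies admitting no further attachment. -/
def Terminal (S : RTAS) (α : Assembly) : Prop :=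
  Producible S α ∧ ∀ β, ¬ Attaches S α β

/-- Apply the reflection `r` and then the translation `v` to the assembly `α`. -/
def transform (α : Assembly) (r : Reflection) (v : ℤ × ℤ) : Assembly :=
  fun p => (α (Reflection.onPoint r (p - v))).map fun pl => (pl.1, Reflection.comp r pl.2)

/-- The configuration of an assembly: forget the reflections of the placed tiles. -/
def config (α : Assembly) : ℤ × ℤ → Option TileType := fun p => (α p).map Prod.fst

/-- A system is directed if any two producible assemblies have the same configuration up
to a reflection and a translation. -/
def RTASDirected (S : RTAS) : Prop :=
  ∀ α β, Producible S α → Producible S β →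
    ∃ (r : Reflection) (v : ℤ × ℤ), config (transform β r v) = config α

/-- A system is singly seeded if its seed consists of a single tile. -/
def SinglySeeded (S : RTAS) : Prop := ∃ p, adom S.seed = {p}

/-- `X` weakly self-assembles in `S`. -/
def WeaklySelfAssembles (S : RTAS) (X : Set (ℤ × ℤ)) : Prop :=
  ∃ B ⊆ S.tiles, ∀ α, Terminal S α →
    ∃ (r : Reflection) (v : ℤ × ℤ),
      {p | ∃ pl, transform α r v p = some pl ∧ pl.1 ∈ B} = X

/-- `X` strictly self-assembles in `S`. -/
def StrictlySelfAssembles (S : RTAS) (X : Set (ℤ × ℤ)) : Prop :=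
  ∀ α, Terminal S α →
    ∃ (r : Reflection) (v : ℤ × ℤ), adom (transform α r v) = X

/-- A semi-doubly periodic subset of `ℤ²`. -/
def SemiDoublyPeriodic (X : Set (ℤ × ℤ)) : Prop :=
  ∃ b u v : ℤ × ℤ, X = {p | ∃ n m : ℕ, p = b + (n : ℤ) • u + (m : ℤ) • v}

/-- A finite union of semi-doubly periodic sets. -/
def FiniteUnionSDP (X : Set (ℤ × ℤ)) : Prop :=
  ∃ (k : ℕ) (f : Fin k → Set (ℤ × ℤ)),
    (∀ i, SemiDoublyPeriodic (f i)) ∧ X = ⋃ i, f i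

/-- The box of radius `c` centered at `v`. -/
def box (c : ℕ) (v : ℤ × ℤ) : Set (ℤ × ℤ) :=
  {p | |p.1 - v.1| ≤ (c : ℤ) ∧ |p.2 - v.2| ≤ (c : ℤ)}

/-- The `n × m` rectangle `{0, …, n−1} × {0, …, m−1} ⊆ ℤ²`. -/
def rectShape (n m : ℕ) : Set (ℤ × ℤ) :=
  {p | 0 ≤ p.1 ∧ p.1 < (n : ℤ) ∧ 0 ≤ p.2 ∧ p.2 < (m : ℤ)}

/-- The `n × n` square `{0, …, n−1}² ⊆ ℤ²`. -/
def squareShape (n : ℕ) : Set (ℤ × ℤ) := rectShape n n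

/-- Grid adjacency on `ℤ²`. -/
def GridAdj (p q : ℤ × ℤ) : Prop := (p.1 - q.1).natAbs + (p.2 - q.2).natAbs = 1

/-- `X` is connected in the grid graph. -/
def GridConnectedOn (X : Set (ℤ × ℤ)) : Prop :=
  ∀ p ∈ X, ∀ q ∈ X, Relation.ReflTransGen (fun a b => GridAdj a b ∧ a ∈ X ∧ b ∈ X) p q

/-- A shape: a finite nonempty connected subset of `ℤ²`. -/
def IsShape (X : Set (ℤ × ℤ)) : Prop := X.Finite ∧ X.Nonempty ∧ GridConnectedOn X

/-- A system is mismatch-free: in every producible assembly, abutting sides of adjacent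
tiles are either both null or carry complementary glues of equal strength. -/
def MismatchFree (S : RTAS) : Prop :=
  ∀ α, Producible S α → ∀ p q a b, GridAdj p q → α p = some a → α q = some b →
    GlueMatch (facingGlue a p q) (facingGlue b q p)

/-- `X` is odd-symmetric with respect to some horizontal or vertical line through lattice
points. -/
def OddSymmetric (X : Set (ℤ × ℤ)) : Prop :=
  (∃ l : ℤ, ∀ a b : ℤ, ((a, l - b) ∈ X ↔ (a, l + b) ∈ X)) ∨
  (∃ l : ℤ, ∀ a b : ℤ, ((l - a, b) ∈ X ↔ (l + a, b) ∈ X))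

/-- The binding graph of `α` is a tree: connected on `adom α` and every edge is a bridge. -/
def BindingGraphIsTree (α : Assembly) : Prop :=
  (∀ p ∈ adom α, ∀ q ∈ adom α, Relation.ReflTransGen (BondAdj α) p q) ∧
  (∀ p q, BondAdj α p q →
    ¬ Relation.ReflTransGen
      (fun a b => BondAdj α a b ∧ ¬((a = p ∧ b = q) ∨ (a = q ∧ b = p))) p q)

/-- A spanning tree of the grid graph of a shape `X`. -/
structure TreeOf (X : Set (ℤ × ℤ)) where
  adj : ℤ × ℤ → ℤ × ℤ → Prop
  symm : ∀ p q, adj p q → adj q p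
  valid : ∀ p q, adj p q → p ∈ X ∧ q ∈ X ∧ GridAdj p q
  connected : ∀ p ∈ X, ∀ q ∈ X, Relation.ReflTransGen adj p q
  acyclic : ∀ p q, adj p q →
    ¬ Relation.ReflTransGen
      (fun a b => adj a b ∧ ¬((a = p ∧ b = q) ∨ (a = q ∧ b = p))) p q

/-- The vertex set of a horizontal axis at height `l` from `x₁` to `x₂`. -/
def hAxisSet (l x₁ x₂ : ℤ) : Set (ℤ × ℤ) := {p | p.2 = l ∧ x₁ ≤ p.1 ∧ p.1 ≤ x₂}

/-- The vertex set of a vertical axis at abscissa `l` from `y₁` to `y₂`. -/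
def vAxisSet (l y₁ y₂ : ℤ) : Set (ℤ × ℤ) := {p | p.1 = l ∧ y₁ ≤ p.2 ∧ p.2 ≤ y₂}

/-- A (maximal) horizontal axis of the tree `t`: consecutive vertices on the line `y = l`
joined by tree edges, not extendable on either end. -/
def IsHAxis {X : Set (ℤ × ℤ)} (t : TreeOf X) (l x₁ x₂ : ℤ) : Prop :=
  x₁ ≤ x₂ ∧ (∀ x, x₁ ≤ x → x ≤ x₂ → ((x, l) : ℤ × ℤ) ∈ X) ∧
  (∀ x, x₁ ≤ x → x < x₂ → t.adj (x, l) (x + 1, l)) ∧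
  ¬ t.adj (x₁ - 1, l) (x₁, l) ∧ ¬ t.adj (x₂, l) (x₂ + 1, l)

/-- A (maximal) vertical axis of the tree `t`. -/
def IsVAxis {X : Set (ℤ × ℤ)} (t : TreeOf X) (l y₁ y₂ : ℤ) : Prop :=
  y₁ ≤ y₂ ∧ (∀ y, y₁ ≤ y → y ≤ y₂ → ((l, y) : ℤ × ℤ) ∈ X) ∧
  (∀ y, y₁ ≤ y → y < y₂ → t.adj (l, y) (l, y + 1)) ∧
  ¬ t.adj (l, y₁ - 1) (l, y₁) ∧ ¬ t.adj (l, y₂) (l, y₂ + 1)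

/-- The union of the axial branches of `t` beginning from `v` relative to the axis `a`
(together with `v` itself): everything reachable from `v` through a neighbor not on `a`
without revisiting `v`. -/
def branch {X : Set (ℤ × ℤ)} (t : TreeOf X) (a : Set (ℤ × ℤ)) (v : ℤ × ℤ) :
    Set (ℤ × ℤ) :=
  {v} ∪ {p | ∃ w, t.adj v w ∧ w ∉ a ∧
    Relation.ReflTransGen (fun x y => t.adj x y ∧ x ≠ v ∧ y ≠ v) w p}

/-- The axial branches of `t` beginning from `v` are symmetric across the reflection `ρ`
(of `ℤ²` across the line of the axis `a`). -/
def BranchSymmetric {X : Set (ℤ × ℤ)} (t : TreeOf X) (a : Set (ℤ × ℤ))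
    (ρ : ℤ × ℤ → ℤ × ℤ) (v : ℤ × ℤ) : Prop :=
  (∀ p ∈ branch t a v, ρ p ∈ branch t a v) ∧
  (∀ p q, p ∈ branch t a v → q ∈ branch t a v → t.adj p q → t.adj (ρ p) (ρ q))

/-- `t` is off-by-one symmetric across the horizontal axis determined by `(l, x₁, x₂)`:
the branches from every vertex of the axis, except at most one, are symmetric across it. -/
def OffByOneH {X : Set (ℤ × ℤ)} (t : TreeOf X) (l x₁ x₂ : ℤ) : Prop :=
  ∃ v₀ : ℤ × ℤ, ∀ x, x₁ ≤ x → x ≤ x₂ → ((x, l) : ℤ × ℤ) ≠ v₀ →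
    BranchSymmetric t (hAxisSet l x₁ x₂) (fun p => (p.1, 2 * l - p.2)) (x, l)

/-- `t` is off-by-one symmetric across the vertical axis determined by `(l, y₁, y₂)`. -/
def OffByOneV {X : Set (ℤ × ℤ)} (t : TreeOf X) (l y₁ y₂ : ℤ) : Prop :=
  ∃ v₀ : ℤ × ℤ, ∀ y, y₁ ≤ y → y ≤ y₂ → ((l, y) : ℤ × ℤ) ≠ v₀ →
    BranchSymmetric t (vAxisSet l y₁ y₂) (fun p => (2 * l - p.1, p.2)) (l, y)

/-- A tree is ε-symmetric if it is off-by-one symmetric across each of its axes. -/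
def TreeOf.EpsSymmetric {X : Set (ℤ × ℤ)} (t : TreeOf X) : Prop :=
  (∀ l x₁ x₂, IsHAxis t l x₁ x₂ → OffByOneH t l x₁ x₂) ∧
  (∀ l y₁ y₂, IsVAxis t l y₁ y₂ → OffByOneV t l y₁ y₂)

/-- A shape is ε-symmetric if some spanning tree of its grid graph is ε-symmetric. -/
def EpsSymmetricShape (X : Set (ℤ × ℤ)) : Prop :=
  ∃ t : TreeOf X, TreeOf.EpsSymmetric t

/-- The `c`-scaling of a shape: replace each point by a `c × c` block. -/
def scaleShape (X : Set (ℤ × ℤ)) (c : ℕ) : Set (ℤ × ℤ) :=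
  {p | (Int.fdiv p.1 (c : ℤ), Int.fdiv p.2 (c : ℤ)) ∈ X}

/-- The assembly encoded by a finite list of placed tiles. -/
def listAssembly (L : List ((ℤ × ℤ) × Placement)) : Assembly :=
  fun p => (L.find? fun e => decide (e.1 = p)).map Prod.snd

/-! ### Stability at temperature one -/

theorem glueBind_comm (g h : Glue) : glueBind g h = glueBind h g := by
  rcases g with _ | ⟨a, s⟩ <;> rcases h with _ | ⟨b, t⟩ <;> simp only [glueBind]
  split_ifs <;> grind

theorem bondStrength_comm (α : Assembly) (p q : ℤ × ℤ) :
    bondStrength α p q = bondStrength α q p := by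
  unfold bondStrength
  cases α p <;> cases α q <;> simp [glueBind_comm]

theorem bondStrength_of_eq_some {α : Assembly} {p q : ℤ × ℤ} {a b : Placement}
    (hp : α p = some a) (hq : α q = some b) :
    bondStrength α p q = glueBind (facingGlue a p q) (facingGlue b q p) := by
  simp [bondStrength, hp, hq]

theorem exists_of_bondStrength_pos {α : Assembly} {p q : ℤ × ℤ} (h : 0 < bondStrength α p q) :
    ∃ a b, α p = some a ∧ α q = some b ∧
      0 < glueBind (facingGlue a p q) (facingGlue b q p) := by
  unfold bondStrength at h
  cases hp : α p <;> cases hq : α q <;> simp_all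

theorem bondStrength_pos_mono {α β : Assembly} (hle : ∀ p pl, α p = some pl → β p = some pl)
    {p q : ℤ × ℤ} (h : 0 < bondStrength α p q) : 0 < bondStrength β p q := by
  obtain ⟨a, b, hp, hq, hb⟩ := exists_of_bondStrength_pos h
  rwa [bondStrength_of_eq_some (hle _ _ hp) (hle _ _ hq)]

theorem mem_adom_iff {α : Assembly} {p : ℤ × ℤ} : p ∈ adom α ↔ ∃ pl, α p = some pl :=
  Option.ne_none_iff_exists'

theorem stable_one_iff (α : Assembly) :
    Stable α 1 ↔ ∀ A : Set (ℤ × ℤ), A ⊆ adom α → A.Nonempty → (adom α \ A).Nonempty →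
      ∃ p ∈ A, ∃ q ∈ adom α \ A, 0 < bondStrength α p q := by
  refine forall_congr' fun A => forall_congr' fun _ => forall_congr' fun _ =>
    forall_congr' fun _ => ⟨?_, ?_⟩
  · rintro ⟨E, hE, hsum⟩
    obtain ⟨e, he, hpos⟩ := Finset.exists_ne_zero_of_sum_ne_zero (Nat.ne_of_gt hsum)
    exact ⟨e.1, (hE e he).1, e.2, (hE e he).2, Nat.pos_of_ne_zero hpos⟩
  · rintro ⟨p, hp, q, hq, h⟩
    exact ⟨{(p, q)}, by simpa using ⟨hp, hq⟩, by simpa using Nat.succ_le_of_lt h⟩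

theorem stable_of_adom_eq_singleton {α : Assembly} {p : ℤ × ℤ} (h : adom α = {p}) (τ : ℕ) :
    Stable α τ := by
  intro A hA hne hne'
  rw [h] at hA hne'
  obtain rfl := (Set.subset_singleton_iff_eq.1 hA).resolve_left hne.ne_empty
  simp at hne'

theorem stable_one_update {α : Assembly} (hα : Stable α 1) {p q : ℤ × ℤ} {a pl : Placement}
    (hp : α p = some a) (hq : α q = none)
    (hb : 0 < glueBind (facingGlue a p q) (facingGlue pl q p)) :
    Stable (Function.update α q (some pl)) 1 := by
  set β := Function.update α q (some pl) with hβ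
  have hpq : p ≠ q := by rintro rfl; simp [hq] at hp
  have hβp : β p = some a := by rw [hβ, Function.update_of_ne hpq, hp]
  have hβq : β q = some pl := by rw [hβ, Function.update_self]
  have hle : ∀ x c, α x = some c → β x = some c := by
    intro x c hx
    rw [hβ, Function.update_of_ne (by rintro rfl; simp [hq] at hx), hx]
  have hbond : 0 < bondStrength β p q := by rwa [bondStrength_of_eq_some hβp hβq]
  have hpα : p ∈ adom α := mem_adom_iff.2 ⟨_, hp⟩
  have hpβ : p ∈ adom β := mem_adom_iff.2 ⟨_, hβp⟩
  have hqβ : q ∈ adom β := mem_adom_iff.2 ⟨_, hβq⟩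
  have hdom : ∀ x, x ≠ q → (x ∈ adom β ↔ x ∈ adom α) := by
    intro x hx
    simp [adom, hβ, Function.update_of_ne hx]
  have hqα : q ∉ adom α := by simp [adom, hq]
  rw [stable_one_iff] at hα ⊢
  rintro A hA ⟨x, hx⟩ ⟨y, hy, hyA⟩
  by_cases hqA : q ∈ A <;> by_cases hpA : p ∈ A
  · have hyq : y ≠ q := by rintro rfl; exact hyA hqA
    obtain ⟨u, hu, w, hw, h⟩ := hα (A \ {q}) (fun z hz => (hdom z hz.2).1 (hA hz.1))
      ⟨p, hpA, hpq⟩ ⟨y, (hdom y hyq).1 hy, fun h => hyA h.1⟩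
    have hwq : w ≠ q := by rintro rfl; exact hqα hw.1
    exact ⟨u, hu.1, w, ⟨(hdom w hwq).2 hw.1, fun h => hw.2 ⟨h, hwq⟩⟩,
      bondStrength_pos_mono hle h⟩
  · exact ⟨q, hqA, p, ⟨hpβ, hpA⟩, bondStrength_comm β p q ▸ hbond⟩
  · exact ⟨p, hpA, q, ⟨hqβ, hqA⟩, hbond⟩
  · have hne : ∀ z ∈ A, z ≠ q := by rintro z hz rfl; exact hqA hz
    obtain ⟨u, hu, w, hw, h⟩ := hα A (fun z hz => (hdom z (hne z hz)).1 (hA hz))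
      ⟨x, hx⟩ ⟨p, hpα, hpA⟩
    have hwq : w ≠ q := by rintro rfl; exact hqα hw.1
    exact ⟨u, hu, w, ⟨(hdom w hwq).2 hw.1, hw.2⟩, bondStrength_pos_mono hle h⟩

/-- A tile attached to a nonempty assembly at temperature one binds to some earlier tile. -/
theorem exists_bond_of_stable_update {α : Assembly} {p₀ q : ℤ × ℤ} {a₀ pl : Placement}
    (hp₀ : α p₀ = some a₀) (hq : α q = none) (h : Stable (Function.update α q (some pl)) 1) :
    ∃ p a, α p = some a ∧ 0 < glueBind (facingGlue a p q) (facingGlue pl q p) := by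
  have hp₀q : p₀ ≠ q := by rintro rfl; simp [hq] at hp₀
  obtain ⟨u, rfl, w, ⟨hw, hwu⟩, hb⟩ := (stable_one_iff _).1 h {q}
    (by rintro _ rfl; simp [adom]) ⟨q, rfl⟩
    ⟨p₀, by simp [adom, Function.update_of_ne hp₀q, hp₀], hp₀q⟩
  obtain ⟨b, a, hb', ha, hpos⟩ := exists_of_bondStrength_pos hb
  rw [Function.update_self] at hb'
  rw [Function.update_of_ne hwu] at ha
  obtain rfl := Option.some.inj hb'
  exact ⟨w, a, ha, glueBind_comm _ _ ▸ hpos⟩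

theorem step_mono {Sys : RTAS} {f : ℕ → Assembly}
    (hf : ∀ n, f (n + 1) = f n ∨ Attaches Sys (f n) (f (n + 1))) {m n : ℕ} (hmn : m ≤ n)
    {p : ℤ × ℤ} {pl : Placement} (h : f m p = some pl) : f n p = some pl := by
  induction n, hmn using Nat.le_induction with
  | base => exact h
  | succ n _ ih =>
    rcases hf n with h' | ⟨q, t, r, hq, -, h', -⟩
    · rw [h', ih]
    · rw [h', Function.update_of_ne (by rintro rfl; simp [hq] at ih), ih]

theorem Producible.stable_one {Sys : RTAS} (hτ : Sys.temp = 1) {α : Assembly}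
    (h : Producible Sys α) : Stable α 1 := by
  obtain ⟨f, h0, hf, hα⟩ := h
  have hst : ∀ n, Stable (f n) 1 := by
    intro n
    induction n with
    | zero => rw [h0, ← hτ]; exact Sys.seed_stable
    | succ n ih =>
      rcases hf n with h | ⟨_, _, _, -, -, -, h⟩
      · rwa [h]
      · rwa [hτ] at h
  have hle : ∀ n p pl, f n p = some pl → α p = some pl := fun n p pl h => (hα p pl).2 ⟨n, h⟩
  rw [stable_one_iff]
  rintro A hA ⟨x, hx⟩ ⟨y, hy, hyA⟩
  obtain ⟨a, ha⟩ := mem_adom_iff.1 (hA hx)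
  obtain ⟨b, hb⟩ := mem_adom_iff.1 hy
  obtain ⟨m, hm⟩ := (hα _ _).1 ha
  obtain ⟨n, hn⟩ := (hα _ _).1 hb
  have hx' : x ∈ adom (f (max m n)) := mem_adom_iff.2 ⟨_, step_mono hf (le_max_left _ _) hm⟩
  have hy' : y ∈ adom (f (max m n)) := mem_adom_iff.2 ⟨_, step_mono hf (le_max_right _ _) hn⟩
  obtain ⟨u, hu, w, hw, h⟩ := (stable_one_iff _).1 (hst (max m n)) (A ∩ adom (f (max m n)))
    Set.inter_subset_right ⟨x, hx, hx'⟩ ⟨y, hy', fun h => hyA h.1⟩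
  obtain ⟨c, hc⟩ := mem_adom_iff.1 hw.1
  exact ⟨u, hu.1, w, ⟨mem_adom_iff.2 ⟨c, hle _ _ _ hc⟩, fun h => hw.2 ⟨h, hw.1⟩⟩,
    bondStrength_pos_mono (hle _) h⟩

/-! ### Systems with a prescribed assembly -/

/-- The glue of an already reflected tile at `p` on the side facing `q`. -/
def sideGlue (g : TileType) (p q : ℤ × ℤ) : Glue := facingGlue (g, (false, false)) p q

theorem facingGlue_eq_sideGlue (pl : Placement) (p q : ℤ × ℤ) :
    facingGlue pl p q = sideGlue (pl.1.reflect pl.2) p q := rfl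

/-- The strength with which reflected tiles `g` at `p` and `h` at `q` bind. -/
def sideBind (g : TileType) (p : ℤ × ℤ) (h : TileType) (q : ℤ × ℤ) : ℕ :=
  glueBind (sideGlue g p q) (sideGlue h q p)

/-- A blueprint for a rigid assembly: a tile type `tile p` for each position `p` of the finite
set `support`, appearing there as `placed p` and attaching to the position `parent p`, such that
away from its parent a placed tile binds only to intended children, and such that the intended
bonds connect `support`. -/
structure Blueprint where
  support : Finset (ℤ × ℤ)
  tile : ℤ × ℤ → TileType
  placed : ℤ × ℤ → TileType
  parent : ℤ × ℤ → ℤ × ℤ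
  origin_mem : (0, 0) ∈ support
  placed_origin : placed (0, 0) = tile (0, 0)
  parent_origin : parent (0, 0) = (0, 0)
  exists_reflect : ∀ p ∈ support, ∃ r, (tile p).reflect r = placed p
  rigid : ∀ p ∈ support, ∀ q, ∀ q' ∈ support, ∀ r,
    0 < sideBind (placed p) p ((tile q').reflect r) q →
      q = parent p ∨
        (q ∈ support ∧ tile q' = tile q ∧ (tile q').reflect r = placed q ∧ parent q = p)
  connected : ∀ p ∈ support, Relation.ReflTransGen
    (fun a b => b ∈ support ∧ 0 < sideBind (placed a) a (placed b) b) (0, 0) p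

namespace Blueprint

variable (P : Blueprint)

/-- The seed of a blueprint: the tile of the origin. -/
def seed : Assembly :=
  Function.update (fun _ => none) (0, 0) (some (P.tile (0, 0), (false, false)))

theorem seed_eq_some {p : ℤ × ℤ} {pl : Placement} :
    P.seed p = some pl ↔ p = (0, 0) ∧ pl = (P.tile (0, 0), (false, false)) := by
  by_cases h : p = (0, 0)
  · subst h
    simp [seed, eq_comm]
  · simp [seed, h]

theorem adom_seed : adom P.seed = {(0, 0)} := by
  ext p
  simp [mem_adom_iff, seed_eq_some]

open Classical in
/-- The singly seeded temperature-1 system of a blueprint. -/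
noncomputable def system : RTAS where
  tiles := P.support.image P.tile
  seed := P.seed
  temp := 1
  seed_nonempty := by rw [adom_seed]; exact Set.singleton_nonempty _
  seed_finite := by rw [adom_seed]; exact Set.finite_singleton _
  seed_tiles := by
    intro p pl h
    rw [(P.seed_eq_some.1 h).2]
    exact Finset.mem_image_of_mem _ P.origin_mem
  seed_stable := stable_of_adom_eq_singleton P.adom_seed 1

theorem mem_tiles {t : TileType} : t ∈ P.system.tiles ↔ ∃ p ∈ P.support, P.tile p = t := by
  classical
  exact Finset.mem_image

/-- The placement `pl` at `p` follows the blueprint. -/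
def Follows (p : ℤ × ℤ) (pl : Placement) : Prop :=
  p ∈ P.support ∧ pl.1 = P.tile p ∧ pl.1.reflect pl.2 = P.placed p

variable {P}

theorem follows_of_producible {α : Assembly} (h : Producible P.system α) {p : ℤ × ℤ}
    {pl : Placement} (hp : α p = some pl) : P.Follows p pl := by
  obtain ⟨f, h0, hf, hα⟩ := h
  have hall : ∀ n p pl, f n p = some pl → P.Follows p pl ∧ P.parent p ∈ adom (f n) := by
    intro n
    induction n with
    | zero =>
      intro p pl h
      rw [h0] at h
      obtain ⟨rfl, rfl⟩ := P.seed_eq_some.1 h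
      refine ⟨⟨P.origin_mem, rfl, P.placed_origin.symm⟩, ?_⟩
      rw [P.parent_origin, h0]
      exact mem_adom_iff.2 ⟨_, P.seed_eq_some.2 ⟨rfl, rfl⟩⟩
    | succ n ih =>
      rcases hf n with h | ⟨q, t, r, hq, ht, h, hst⟩
      · rwa [h]
      · have hdom : ∀ x ∈ adom (f n), x ∈ adom (f (n + 1)) := by
          intro x hx
          obtain ⟨c, hc⟩ := mem_adom_iff.1 hx
          exact mem_adom_iff.2 ⟨c, step_mono hf n.le_succ hc⟩
        intro p pl hp
        by_cases hpq : p = q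
        · subst hpq
          rw [h, Function.update_self] at hp
          obtain rfl := Option.some.inj hp
          have hroot : f 0 (0, 0) = some (P.tile (0, 0), (false, false)) := by
            rw [h0]; exact P.seed_eq_some.2 ⟨rfl, rfl⟩
          obtain ⟨u, a, ha, hb⟩ := exists_bond_of_stable_update
            (step_mono hf (Nat.zero_le n) hroot) hq (h ▸ hst)
          obtain ⟨q', hq', rfl⟩ := P.mem_tiles.1 ht
          obtain ⟨⟨hu, -, ha'⟩, hpar⟩ := ih u a ha
          rw [facingGlue_eq_sideGlue, facingGlue_eq_sideGlue, ha'] at hb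
          rcases P.rigid u hu p q' hq' r hb with rfl | ⟨h1, h2, h3, h4⟩
          · exact absurd hq hpar
          · exact ⟨⟨h1, h2, h3⟩, h4 ▸ hdom u (mem_adom_iff.2 ⟨a, ha⟩)⟩
        · rw [h, Function.update_of_ne hpq] at hp
          exact ⟨(ih p pl hp).1, hdom _ (ih p pl hp).2⟩
  obtain ⟨n, hn⟩ := (hα p pl).1 hp
  exact (hall n p pl hn).1

theorem mem_adom_of_terminal {α : Assembly} (h : Terminal P.system α) {p : ℤ × ℤ}
    (hp : p ∈ P.support) : p ∈ adom α := by
  induction P.connected p hp with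
  | refl =>
    obtain ⟨f, h0, -, hα⟩ := h.1
    exact mem_adom_iff.2 ⟨_, (hα _ _).2 ⟨0, by rw [h0]; exact P.seed_eq_some.2 ⟨rfl, rfl⟩⟩⟩
  | @tail u w _ huw ih =>
    obtain ⟨hw, hb⟩ := huw
    have hu : u ∈ adom α := by
      by_cases hu : u ∈ P.support
      · exact ih hu
      · rename_i hpath
        rcases Relation.ReflTransGen.cases_tail hpath with h' | ⟨_, -, h', -⟩
        · exact absurd (h' ▸ P.origin_mem) hu
        · exact absurd h' hu
    obtain ⟨a, ha⟩ := mem_adom_iff.1 hu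
    obtain ⟨r, hr⟩ := P.exists_reflect w hw
    by_contra hn
    have hn : α w = none := by simpa [adom] using hn
    refine h.2 _ ⟨w, P.tile w, r, hn, P.mem_tiles.2 ⟨w, hw, rfl⟩, rfl, ?_⟩
    refine stable_one_update (h.1.stable_one rfl) ha hn ?_
    rw [facingGlue_eq_sideGlue, facingGlue_eq_sideGlue, (follows_of_producible h.1 ha).2.2, hr]
    exact hb

theorem weaklySelfAssembles {X : Set (ℤ × ℤ)} (v : ℤ × ℤ)
    (hX : ∀ p ∈ X, p - v ∈ P.support)
    (htile : ∀ p ∈ P.support, ∀ q ∈ P.support, P.tile p = P.tile q → p + v ∈ X → q + v ∈ X) :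
    WeaklySelfAssembles P.system X := by
  classical
  refine ⟨(P.support.filter fun p => p + v ∈ X).image P.tile,
    Finset.image_subset_image (Finset.filter_subset _ _), fun α hα => ⟨(false, false), v, ?_⟩⟩
  have htr : ∀ p, transform α (false, false) v p = α (p - v) := by
    intro p
    have : ∀ pl : Placement, (pl.1, Reflection.comp (false, false) pl.2) = pl := by
      simp [Reflection.comp]
    simp [transform, Reflection.onPoint, this, Prod.sub_def]
  ext p
  simp only [htr, Set.mem_ofPred_eq, Finset.mem_image, Finset.mem_filter]
  constructor
  · rintro ⟨pl, hp, q, ⟨hq, hqX⟩, hqt⟩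
    obtain ⟨hps, hpt, -⟩ := follows_of_producible hα.1 hp
    simpa using htile q hq (p - v) hps (hqt.trans hpt) hqX
  · intro hp
    obtain ⟨pl, hpl⟩ := mem_adom_iff.1 (mem_adom_of_terminal hα (hX p hp))
    exact ⟨pl, hpl, p - v, ⟨hX p hp, by simpa using hp⟩,
      (follows_of_producible hα.1 hpl).2.1.symm⟩

end Blueprint

/-! ### Transposition -/

/-- The mirror image of a tile across the diagonal. -/
def TileType.transpose (t : TileType) : TileType := (t.2.1, t.1, t.2.2.2, t.2.2.1)

theorem transpose_reflect (t : TileType) (r : Reflection) :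
    (t.transpose).reflect r = (t.reflect r.swap).transpose := rfl

theorem transpose_injective : Function.Injective TileType.transpose := by
  rintro ⟨_, _, _, _⟩ ⟨_, _, _, _⟩ h
  simp_all [TileType.transpose]

theorem sideBind_transpose (g h : TileType) (p q : ℤ × ℤ) :
    sideBind g.transpose p h.transpose q = sideBind g p.swap h q.swap := by
  have key : ∀ (g : TileType) (p q : ℤ × ℤ),
      sideGlue g.transpose p q = sideGlue g p.swap q.swap := by
    rintro g ⟨a, b⟩ ⟨c, d⟩
    simp only [sideGlue, facingGlue, Prod.swap, Prod.mk.injEq, TileType.reflect,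
      TileType.transpose, TileType.north, TileType.east, TileType.south, TileType.west]
    split_ifs <;> first | rfl | omega
  simp only [sideBind, key]

/-- The mirror image of a blueprint across the diagonal. -/
def Blueprint.transpose (P : Blueprint) : Blueprint where
  support := P.support.map (Equiv.prodComm ℤ ℤ).toEmbedding
  tile p := (P.tile p.swap).transpose
  placed p := (P.placed p.swap).transpose
  parent p := (P.parent p.swap).swap
  origin_mem := by simpa using P.origin_mem
  placed_origin := congrArg TileType.transpose P.placed_origin
  parent_origin := congrArg Prod.swap P.parent_origin
  exists_reflect := by
    rintro ⟨a, b⟩ hp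
    obtain ⟨r, hr⟩ := P.exists_reflect (b, a) (by simpa using hp)
    exact ⟨r.swap, by simp [transpose_reflect, hr]⟩
  rigid := by
    rintro ⟨a, b⟩ hp ⟨c, d⟩ ⟨c', d'⟩ hq r h
    rw [transpose_reflect, sideBind_transpose] at h
    rcases P.rigid (b, a) (by simpa using hp) (d, c) (d', c') (by simpa using hq) r.swap h with
      h | ⟨h1, h2, h3, h4⟩
    · exact .inl (congrArg Prod.swap h)
    · exact .inr ⟨by simpa using h1, congrArg _ h2, congrArg TileType.transpose h3,
        congrArg Prod.swap h4⟩
  connected := by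
    rintro ⟨a, b⟩ hp
    refine (P.connected (b, a) (by simpa using hp)).lift (f := Prod.swap) ?_
    rintro ⟨a, b⟩ ⟨c, d⟩ ⟨h1, h2⟩
    exact ⟨by simpa using h1, by rwa [sideBind_transpose]⟩

/-! ### Bonds in the four directions -/

theorem sideBind_comm (g h : TileType) (p q : ℤ × ℤ) : sideBind g p h q = sideBind h q g p :=
  glueBind_comm _ _

theorem sideBind_right (g h : TileType) (a b : ℤ) :
    sideBind g (a, b) h (a + 1, b) = glueBind g.east h.west := by
  have h1 : a ≠ a + 1 + 1 := by omega
  simp [sideBind, sideGlue, facingGlue, TileType.reflect, TileType.east, TileType.west, h1]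

theorem sideBind_left (g h : TileType) (a b : ℤ) :
    sideBind g (a, b) h (a - 1, b) = glueBind g.west h.east := by
  rw [sideBind_comm, glueBind_comm]
  simpa using sideBind_right h g (a - 1) b

theorem sideBind_up (g h : TileType) (a b : ℤ) :
    sideBind g (a, b) h (a, b + 1) = glueBind g.north h.south := by
  have h1 : b ≠ b + 1 + 1 := by omega
  simp [sideBind, sideGlue, facingGlue, TileType.reflect, TileType.north, TileType.south, h1]

theorem sideBind_down (g h : TileType) (a b : ℤ) :
    sideBind g (a, b) h (a, b - 1) = glueBind g.south h.north := by
  rw [sideBind_comm, glueBind_comm]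
  simpa using sideBind_up h g a (b - 1)

theorem eq_neighbor_of_sideBind_pos {g h : TileType} {p q : ℤ × ℤ} (hb : 0 < sideBind g p h q) :
    q = (p.1 + 1, p.2) ∨ q = (p.1 - 1, p.2) ∨ q = (p.1, p.2 + 1) ∨ q = (p.1, p.2 - 1) := by
  by_contra! hn
  simp [sideBind, sideGlue, facingGlue, hn, glueBind] at hb

/-! ### The comb -/

/-- A positive strength determined by, and determining, a position. -/
def posCode (p : ℤ × ℤ) : ℕ := Encodable.encode p + 1

theorem posCode_inj {p q : ℤ × ℤ} : posCode p = posCode q ↔ p = q := by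
  simp [posCode, Encodable.encode_inj]

theorem posCode_pos (p : ℤ × ℤ) : 0 < posCode p := Nat.succ_pos _

/-- The tile types of a comb: those of the spine `x = 0`, which is vertical, bind teeth on both
sides; those of the teeth depend only on `y` and `|x|`. -/
def combTile (p : ℤ × ℤ) : TileType :=
  if p.1 = 0 then
    (some (1, posCode (0, p.2)), some (2, posCode (0, p.2)),
      some (-1, posCode (0, p.2 - 1)), some (2, posCode (0, p.2)))
  else (none, some (2, posCode (|p.1|, p.2)), none, some (-2, posCode (|p.1| - 1, p.2)))

/-- The tiles of a comb, reflected on the left side. -/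
def combPlaced (p : ℤ × ℤ) : TileType := (combTile p).reflect (decide (p.1 < 0), false)

/-- The neighbor to which the tile at a given position of a comb attaches. -/
def combParent (p : ℤ × ℤ) : ℤ × ℤ :=
  if 0 < p.1 then (p.1 - 1, p.2) else if p.1 < 0 then (p.1 + 1, p.2)
  else if 0 < p.2 then (0, p.2 - 1) else if p.2 < 0 then (0, p.2 + 1) else (0, 0)

theorem combTile_eq_iff {p q : ℤ × ℤ} :
    combTile p = combTile q ↔ |p.1| = |q.1| ∧ p.2 = q.2 := by
  unfold combTile
  split_ifs with h1 h2 h2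
  all_goals simp only [Prod.mk.injEq, Option.some.injEq, posCode_inj]
  all_goals grind

theorem combPlaced_zero (b : ℤ) : combPlaced (0, b) = combTile (0, b) := rfl

theorem combPlaced_of_pos {a : ℤ} (ha : 0 < a) (b : ℤ) : combPlaced (a, b) =
    (none, some (2, posCode (a, b)), none, some (-2, posCode (a - 1, b))) := by
  simp [combPlaced, combTile, TileType.reflect, TileType.north, TileType.south, TileType.east,
    TileType.west, ha.ne', ha.not_gt, abs_of_pos ha]

theorem combPlaced_of_neg {a : ℤ} (ha : a < 0) (b : ℤ) : combPlaced (a, b) =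
    (none, some (-2, posCode (-a - 1, b)), none, some (2, posCode (-a, b))) := by
  simp [combPlaced, combTile, TileType.reflect, TileType.north, TileType.south, TileType.east,
    TileType.west, ha.ne, ha, abs_of_neg ha]

theorem combTile_of_ne {a : ℤ} (ha : a ≠ 0) (b : ℤ) : combTile (a, b) =
    (none, some (2, posCode (|a|, b)), none, some (-2, posCode (|a| - 1, b))) := by
  simp [combTile, ha]

theorem combTile_zero (b : ℤ) : combTile (0, b) =
    (some (1, posCode (0, b)), some (2, posCode (0, b)),
      some (-1, posCode (0, b - 1)), some (2, posCode (0, b))) := rfl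

theorem eq_some_of_glueBind_pos {g h : Glue} (hb : 0 < glueBind g h) :
    ∃ l s, g = some (l, s) ∧ h = some (-l, s) := by
  rcases g with _ | ⟨a, s⟩ <;> rcases h with _ | ⟨b, t⟩ <;> simp only [glueBind] at hb
  all_goals grind

set_option maxHeartbeats 3000000 in
theorem combTile_rigid {p q q' : ℤ × ℤ} {r : Reflection}
    (h : 0 < sideBind (combPlaced p) p ((combTile q').reflect r) q) :
    q = combParent p ∨ (|q'.1| = |q.1| ∧ q'.2 = q.2 ∧
      (combTile q').reflect r = combPlaced q ∧ combParent q = p) := by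
  obtain ⟨a, b⟩ := p
  obtain ⟨e, f⟩ := q'
  obtain ⟨s, t⟩ := r
  rcases eq_neighbor_of_sideBind_pos h with rfl | rfl | rfl | rfl <;>
  simp only [sideBind_right, sideBind_left, sideBind_up, sideBind_down] at h ⊢ <;>
  obtain ⟨l, n, h1, h2⟩ := eq_some_of_glueBind_pos h <;>
  clear h <;>
  rcases lt_trichotomy a 0 with ha | rfl | ha <;>
  (first
    | rw [combPlaced_of_neg ha] at h1
    | rw [combPlaced_of_pos ha] at h1
    | rw [combPlaced_zero, combTile_zero] at h1) <;>
  by_cases he : e = 0 <;>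
  (first
    | rw [combTile_of_ne he] at h2 ⊢
    | rw [he, combTile_zero] at h2 ⊢) <;>
  cases s <;> cases t <;>
  simp [TileType.reflect, TileType.north, TileType.south, TileType.east, TileType.west] at h1 h2 ⊢
  all_goals
    obtain ⟨rfl, rfl⟩ := h1
    obtain ⟨hl, h2⟩ := h2
    rw [posCode_inj, Prod.mk.injEq] at h2
    grind [combParent, combPlaced_of_neg, combPlaced_of_pos, combPlaced_zero, combTile_zero]

theorem combPlaced_bind_up (b : ℤ) :
    0 < sideBind (combPlaced (0, b)) (0, b) (combPlaced (0, b + 1)) (0, b + 1) := by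
  simp [sideBind_up, combPlaced, combTile, TileType.reflect, TileType.north,
    TileType.south, glueBind, posCode_pos]

theorem combPlaced_bind_right {a : ℤ} (ha : 0 ≤ a) (b : ℤ) :
    0 < sideBind (combPlaced (a, b)) (a, b) (combPlaced (a + 1, b)) (a + 1, b) := by
  rw [sideBind_right, combPlaced_of_pos (show 0 < a + 1 by omega)]
  rcases ha.eq_or_lt with rfl | ha
  · simp [combPlaced_zero, combTile_zero, TileType.east, TileType.west, glueBind, posCode_pos]
  · simp [combPlaced_of_pos ha, TileType.east, TileType.west, glueBind, posCode_pos]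

theorem combPlaced_bind_left {a : ℤ} (ha : a ≤ 0) (b : ℤ) :
    0 < sideBind (combPlaced (a, b)) (a, b) (combPlaced (a - 1, b)) (a - 1, b) := by
  rw [sideBind_left, combPlaced_of_neg (show a - 1 < 0 by omega)]
  rcases ha.eq_or_lt with rfl | ha
  · simp [combPlaced_zero, combTile_zero, TileType.east, TileType.west, glueBind, posCode_pos]
  · simp [combPlaced_of_neg ha, TileType.east, TileType.west, glueBind, posCode_pos]

/-- The comb filling the square of radius `N`. -/
noncomputable def comb (N : ℕ) : Blueprint where
  support := Finset.Icc (-N : ℤ) N ×ˢ Finset.Icc (-N : ℤ) N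
  tile := combTile
  placed := combPlaced
  parent := combParent
  origin_mem := by simp
  placed_origin := rfl
  parent_origin := rfl
  exists_reflect _ _ := ⟨_, rfl⟩
  rigid := by
    rintro p hp q q' hq r h
    rcases combTile_rigid h with h | ⟨h1, h2, h3, h4⟩
    · exact .inl h
    refine .inr ⟨?_, combTile_eq_iff.2 ⟨h1, h2⟩, h3, h4⟩
    simp only [Finset.mem_product, Finset.mem_Icc, ← abs_le] at hq ⊢
    rwa [← h1, ← h2]
  connected := by
    rintro ⟨x, y⟩ hp
    simp only [Finset.mem_product, Finset.mem_Icc] at hp ⊢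
    obtain ⟨⟨hx, hx'⟩, hy, hy'⟩ := hp
    refine Relation.ReflTransGen.trans (b := (0, y)) ?_ ?_
    · induction y using Int.induction_on with
      | zero => exact .refl
      | succ y ih =>
        exact (ih (by omega) (by omega)).tail ⟨by omega, combPlaced_bind_up _⟩
      | pred y ih =>
        refine (ih (by omega) (by omega)).tail ⟨by omega, ?_⟩
        simpa [sideBind_comm] using combPlaced_bind_up (-(y : ℤ) - 1)
    · induction x using Int.induction_on with
      | zero => exact .refl
      | succ x ih =>
        exact (ih (by omega) (by omega)).tail ⟨by omega, combPlaced_bind_right (by omega) y⟩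
      | pred x ih =>
        exact (ih (by omega) (by omega)).tail ⟨by omega, combPlaced_bind_left (by omega) y⟩

theorem exists_comb_of_finite {S : Set (ℤ × ℤ)} (hS : S.Finite) (v : ℤ × ℤ) :
    ∃ N : ℕ, ∀ p ∈ S, p - v ∈ (comb N).support := by
  obtain ⟨N, hN⟩ := (hS.image fun p => (p - v).1.natAbs + (p - v).2.natAbs).bddAbove
  refine ⟨N, fun p hp => ?_⟩
  have := hN ⟨p, hp, rfl⟩
  simp only [comb, Finset.mem_product, Finset.mem_Icc]
  dsimp only at this
  omega

/-- Every odd-symmetric shape weakly self-assembles in some singly seeded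
temperature-1 RTAM system. -/
theorem rtam_odd_symmetric_weakly_self_assembles
    (S : Set (ℤ × ℤ)) (hS : IsShape S) (hsym : OddSymmetric S) :
    ∃ Sys : RTAS, Sys.temp = 1 ∧ SinglySeeded Sys ∧ WeaklySelfAssembles Sys S := by
  rcases hsym with ⟨l, hl⟩ | ⟨l, hl⟩
  · obtain ⟨N, hN⟩ := exists_comb_of_finite (hS.1.image Prod.swap) (l, 0)
    refine ⟨(comb N).transpose.system, rfl, ⟨_, Blueprint.adom_seed _⟩,
      Blueprint.weaklySelfAssembles (0, l) ?_ ?_⟩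
    · rintro ⟨a, b⟩ hp
      simpa [Blueprint.transpose] using hN (b, a) ⟨(a, b), hp, rfl⟩
    · rintro ⟨a, b⟩ - ⟨c, d⟩ - h hp
      obtain ⟨h1, h2⟩ := combTile_eq_iff.1 (transpose_injective h)
      simp only [Prod.swap] at h1 h2
      subst h2
      rcases abs_eq_abs.1 h1 with rfl | rfl
      · exact hp
      · have := hl a d
        simp only [Prod.mk_add_mk, add_zero] at hp ⊢
        rw [add_comm d, ← this]
        rwa [sub_eq_neg_add]
  · obtain ⟨N, hN⟩ := exists_comb_of_finite hS.1 (l, 0)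
    refine ⟨(comb N).system, rfl, ⟨_, Blueprint.adom_seed _⟩,
      Blueprint.weaklySelfAssembles (l, 0) hN ?_⟩
    rintro ⟨a, b⟩ - ⟨c, d⟩ - h hp
    obtain ⟨h1, h2⟩ := combTile_eq_iff.1 h
    simp only at h1 h2
    subst h2
    rcases abs_eq_abs.1 h1 with rfl | rfl
    · exact hp
    · have := hl c b
      simp only [Prod.mk_add_mk, add_zero] at hp ⊢
      rw [add_comm c, ← this]
      rwa [sub_eq_neg_add]
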